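/- In the symmetric group algebra ℂS_m, the Jucys–Murphy element L_m acts on the Specht module S(λ), λ ⊢ m, with eigenvalues exactly the contents of the removable boxes of λ; more precisely, the restriction of S(λ) to S_{m-1} decomposes as ⊕_x S(λ \ x) over removable boxes x, and L_m acts on the summand S(λ \ x) by the scalar c(x) = j - i. -/

import Mathlib

noncomputable section

open scoped Classical

/-- The complex group algebra `ℂ S_n` of the symmetric group on `n` letters. -/
abbrev SGA (n : ℕ) := MonoidAlgebra ℂ (Equiv.Perm (Fin n))

/-- The row group of a filling `T` of a Young diagram: permutations preserving the row
of every entry. -/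
def rowGroup {n : ℕ} (T : Fin n → ℕ × ℕ) : Finset (Equiv.Perm (Fin n)) :=
  Finset.univ.filter fun σ => ∀ k, (T (σ k)).1 = (T k).1

/-- The column group of a filling `T` of a Young diagram: permutations preserving the
column of every entry. -/
def colGroup {n : ℕ} (T : Fin n → ℕ × ℕ) : Finset (Equiv.Perm (Fin n)) :=
  Finset.univ.filter fun σ => ∀ k, (T (σ k)).2 = (T k).2

/-- The Young symmetrizer `a_λ b_λ` associated to a filling `T` of a Young diagram. -/
def youngSym {n : ℕ} (T : Fin n → ℕ × ℕ) : SGA n :=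
  (∑ σ ∈ rowGroup T, MonoidAlgebra.single σ (1 : ℂ)) *
    (∑ σ ∈ colGroup T, MonoidAlgebra.single σ ((Equiv.Perm.sign σ : ℤ) : ℂ))

/-- The Specht module `S(λ)`, realized as the left ideal of `ℂ S_n` generated by the
Young symmetrizer of a filling `T` of `λ`. -/
def specht {n : ℕ} (T : Fin n → ℕ × ℕ) : Submodule ℂ (SGA n) :=
  Submodule.restrictScalars ℂ (Ideal.span {youngSym T})

/-- The Jucys–Murphy element `L_{n+1} = Σ_{i < n} (i, n)` in `ℂ S_{n+1}`. -/
def JM (n : ℕ) : SGA (n + 1) :=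
  ∑ i : Fin n, MonoidAlgebra.single (Equiv.swap (Fin.castSucc i) (Fin.last n)) (1 : ℂ)

/-- The embedding `ℂ S_n ↪ ℂ S_{n+1}` induced by permutations fixing the last letter. -/
def res (n : ℕ) : SGA n →+* SGA (n + 1) :=
  MonoidAlgebra.mapDomainRingHom ℂ
    (Equiv.Perm.viaEmbeddingHom ⟨Fin.castSucc, Fin.castSucc_injective n⟩)

/-- The set of removable boxes of a Young diagram. -/
def Removable (lam : YoungDiagram) : Set (ℕ × ℕ) :=
  {x | x ∈ lam ∧ ∃ ν : YoungDiagram, ν.cells = lam.cells.erase x}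

namespace SpechtBranching

open Equiv

section Characters

variable {m : ℕ}

/-- The group element `σ` as an element of the group algebra. -/
abbrev sg (σ : Perm (Fin m)) : SGA m := MonoidAlgebra.single σ (1 : ℂ)

/-- The complex-valued sign character (`s = true`) or trivial character (`s = false`). -/
def chi (s : Bool) : Perm (Fin m) →* ℂ :=
  if s then (Int.castRingHom ℂ).toMonoidHom.comp ((Units.coeHom ℤ).comp Perm.sign) else 1

/-- The value of `chi s` on transpositions. -/
def delta (s : Bool) : ℂ := if s then -1 else 1

lemma chi_true (σ : Perm (Fin m)) : chi true σ = ((Perm.sign σ : ℤ) : ℂ) := by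
  simp [chi]

lemma chi_false (σ : Perm (Fin m)) : chi false σ = 1 := by
  simp [chi]

lemma chi_swap (s : Bool) {a b : Fin m} (h : a ≠ b) : chi s (swap a b) = delta s := by
  cases s
  · simp [chi_false, delta]
  · simp [chi_true, delta, Perm.sign_swap h]

lemma chi_mul_self (s : Bool) (σ : Perm (Fin m)) : chi s σ * chi s σ = 1 := by
  cases s
  · simp [chi_false]
  · rcases Int.units_eq_one_or (Perm.sign σ) with h | h <;> simp [chi_true, h]

lemma delta_not (s : Bool) : delta (!s) = -delta s := by
  cases s <;> simp [delta]

lemma delta_mul_self (s : Bool) : delta s * delta s = 1 := by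
  cases s <;> simp [delta]

lemma delta_ne_zero (s : Bool) : delta s ≠ 0 := by
  cases s <;> simp [delta]

lemma sg_mul (σ τ : Perm (Fin m)) : sg σ * sg τ = sg (σ * τ) := by
  simp [MonoidAlgebra.single_mul_single]

lemma sg_mul_mul (σ τ : Perm (Fin m)) (v : SGA m) : sg σ * (sg τ * v) = sg (σ * τ) * v := by
  rw [← mul_assoc, sg_mul]

lemma single_eq_smul (σ : Perm (Fin m)) (c : ℂ) :
    (MonoidAlgebra.single σ c : SGA m) = c • sg σ := by
  simp

end Characters

section Symmetrizers

variable {m : ℕ}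

lemma mem_colGroup {T : Fin m → ℕ × ℕ} {σ : Perm (Fin m)} :
    σ ∈ colGroup T ↔ ∀ k, (T (σ k)).2 = (T k).2 := by
  simp [colGroup]

lemma colGroup_mul {T : Fin m → ℕ × ℕ} {σ τ : Perm (Fin m)} (hσ : σ ∈ colGroup T)
    (hτ : τ ∈ colGroup T) : σ * τ ∈ colGroup T := by
  rw [mem_colGroup] at *
  intro k
  rw [Perm.mul_apply, hσ, hτ]

lemma colGroup_inv {T : Fin m → ℕ × ℕ} {σ : Perm (Fin m)} (hσ : σ ∈ colGroup T) :
    σ⁻¹ ∈ colGroup T := by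
  rw [mem_colGroup] at *
  intro k
  have := hσ (σ⁻¹ k)
  simpa using this.symm

lemma swap_mem_colGroup {T : Fin m → ℕ × ℕ} {a b : Fin m} (h : (T a).2 = (T b).2) :
    swap a b ∈ colGroup T := by
  rw [mem_colGroup]
  intro k
  rw [swap_apply_def]
  split_ifs with h1 h2
  · rw [h1, h]
  · rw [h2, h]
  · rfl

/-- The column (anti)symmetrizer of a filling, twisted by the character `chi s`. -/
def colSym (s : Bool) (T : Fin m → ℕ × ℕ) : SGA m :=
  ∑ σ ∈ colGroup T, chi s σ • sg σ

/-- The Young symmetrizer formed from the columns of `T` with character `chi s`, and the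
rows of `T` with the opposite character. -/
def sym (s : Bool) (T : Fin m → ℕ × ℕ) : SGA m :=
  colSym s T * colSym (!s) (Prod.swap ∘ T)

lemma youngSym_eq_sym (T : Fin m → ℕ × ℕ) : youngSym T = sym false (Prod.swap ∘ T) := by
  have h : rowGroup T = colGroup (Prod.swap ∘ T) := by
    ext σ
    simp [rowGroup, colGroup]
  have h' : Prod.swap ∘ Prod.swap ∘ T = T := rfl
  simp only [youngSym, sym, colSym, h, h', Bool.not_false, chi_true, chi_false,
    ← single_eq_smul]

lemma sg_mul_colSym (s : Bool) {T : Fin m → ℕ × ℕ} {τ : Perm (Fin m)} (hτ : τ ∈ colGroup T) :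
    sg τ * colSym s T = chi s τ • colSym s T := by
  unfold colSym
  rw [Finset.mul_sum, Finset.smul_sum]
  refine Finset.sum_bij (fun σ _ => τ * σ) (fun σ hσ => colGroup_mul hτ hσ)
    (fun _ _ _ _ h => mul_left_cancel h)
    (fun σ hσ => ⟨τ⁻¹ * σ, colGroup_mul (colGroup_inv hτ) hσ, by simp⟩) ?_
  intro σ _
  rw [mul_smul_comm, sg_mul, map_mul, smul_smul, ← mul_assoc, chi_mul_self, one_mul]

lemma colSym_mul_sg (s : Bool) {T : Fin m → ℕ × ℕ} {τ : Perm (Fin m)} (hτ : τ ∈ colGroup T) :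
    colSym s T * sg τ = chi s τ • colSym s T := by
  unfold colSym
  rw [Finset.sum_mul, Finset.smul_sum]
  refine Finset.sum_bij (fun σ _ => σ * τ) (fun σ hσ => colGroup_mul hσ hτ)
    (fun _ _ _ _ h => mul_right_cancel h)
    (fun σ hσ => ⟨σ * τ⁻¹, colGroup_mul hσ (colGroup_inv hτ), by simp⟩) ?_
  intro σ _
  rw [smul_mul_assoc, sg_mul, map_mul, smul_smul, mul_left_comm, chi_mul_self, mul_one]

lemma sum_smul_of_equivariant {A : Type*} [AddCommGroup A] [Module ℂ A] (s : Bool)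
    (T : Fin m → ℕ × ℕ) (F : Perm (Fin m) → A) (v : A)
    (h : ∀ τ ∈ colGroup T, F τ = chi s τ • v) :
    ∑ τ ∈ colGroup T, chi s τ • F τ = ((colGroup T).card : ℂ) • v := by
  rw [Finset.sum_congr rfl (fun τ hτ => by rw [h τ hτ, smul_smul, chi_mul_self, one_smul]),
    Finset.sum_const, Nat.cast_smul_eq_nsmul]

lemma card_colGroup_ne_zero (T : Fin m → ℕ × ℕ) : ((colGroup T).card : ℂ) ≠ 0 := by
  rw [Nat.cast_ne_zero]
  exact Finset.card_ne_zero_of_mem (a := 1) (by simp [mem_colGroup])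

/-- `T` is a bijective filling of the Young diagram `μ`. -/
structure IsFilling (μ : YoungDiagram) (T : Fin m → ℕ × ℕ) : Prop where
  inj : Function.Injective T
  range : Set.range T = ↑μ.cells

variable {μ : YoungDiagram} {T : Fin m → ℕ × ℕ}

lemma IsFilling.mem (h : IsFilling μ T) (k : Fin m) : T k ∈ μ := by
  have : T k ∈ Set.range T := ⟨k, rfl⟩
  rw [h.range] at this
  simpa using this

lemma IsFilling.exists_eq (h : IsFilling μ T) {p : ℕ × ℕ} (hp : p ∈ μ) : ∃ k, T k = p := by
  have : p ∈ Set.range T := by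
    rw [h.range]
    simpa using hp
  exact this

lemma IsFilling.transpose (h : IsFilling μ T) : IsFilling μ.transpose (Prod.swap ∘ T) := by
  refine ⟨Prod.swap_injective.comp h.inj, ?_⟩
  ext p
  simp only [Set.mem_range, Function.comp, Finset.mem_coe, YoungDiagram.mem_cells,
    YoungDiagram.mem_transpose]
  constructor
  · rintro ⟨k, rfl⟩
    simpa using h.mem k
  · intro hp
    obtain ⟨k, hk⟩ := h.exists_eq hp
    exact ⟨k, by simp [hk]⟩

lemma IsFilling.comp (h : IsFilling μ T) (σ : Perm (Fin m)) : IsFilling μ (T ∘ σ) :=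
  ⟨h.inj.comp σ.injective, by rw [σ.surjective.range_comp, h.range]⟩

lemma IsFilling.exists_perm (h : IsFilling μ T) {t : Fin m → ℕ × ℕ} (ht : IsFilling μ t) :
    ∃ σ : Perm (Fin m), t = T ∘ ⇑σ⁻¹ := by
  choose f hf using fun k => h.exists_eq (ht.mem k)
  have hfi : Function.Injective f := fun a b hab => ht.inj (by rw [← hf, ← hf, hab])
  refine ⟨(Equiv.ofBijective f (Finite.injective_iff_bijective.mp hfi))⁻¹, ?_⟩
  funext k
  simp [hf]

lemma IsFilling.card_col (h : IsFilling μ T) (j : ℕ) :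
    (Finset.univ.filter fun k => (T k).2 = j).card = μ.colLen j := by
  rw [YoungDiagram.colLen_eq_card]
  refine Finset.card_bij (fun k _ => T k) ?_ (fun _ _ _ _ hab => h.inj hab) ?_
  · intro k hk
    rw [YoungDiagram.mem_col_iff]
    exact ⟨h.mem k, by simpa using hk⟩
  · intro p hp
    rw [YoungDiagram.mem_col_iff] at hp
    obtain ⟨k, hk⟩ := h.exists_eq hp.1
    exact ⟨k, by simp [hk, hp.2], hk⟩

lemma IsFilling.colGroup_inter (h : IsFilling μ T) {c r : Perm (Fin m)} (hc : c ∈ colGroup T)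
    (hr : r ∈ colGroup (Prod.swap ∘ T)) (hcr : c * r = 1) : c = 1 ∧ r = 1 := by
  have hrc : r = c⁻¹ := (inv_eq_of_mul_eq_one_right hcr).symm
  have hr1 : r = 1 := by
    ext k
    congr 1
    apply h.inj
    refine Prod.ext ?_ ?_
    · simpa using mem_colGroup.mp hr k
    · rw [hrc]
      simpa using mem_colGroup.mp (colGroup_inv hc) k
  exact ⟨by simpa [hr1] using hcr, hr1⟩

/-- A map sending each entry to a box of the same row, injectively and with the prescribed
column statistics, stays inside the diagram. -/
lemma IsFilling.mem_of_injective (h : IsFilling μ T) (g : Perm (Fin m))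
    (hinj : Function.Injective fun k => ((T k).1, (T (g k)).2)) (k : Fin m) :
    ((T k).1, (T (g k)).2) ∈ μ := by
  set H : Fin m → ℕ × ℕ := fun k => ((T k).1, (T (g k)).2) with hH
  let w : ℕ × ℕ → ℤ := fun p => (p.2 : ℤ) - μ.rowLen p.1
  have hw : ∀ p, p ∈ μ.cells ↔ w p < 0 := by
    rintro ⟨a, b⟩
    rw [YoungDiagram.mem_cells, YoungDiagram.mem_iff_lt_rowLen]
    simp [w]
  have himg : Finset.univ.image T = μ.cells := by
    rw [← Finset.coe_inj, Finset.coe_image, Finset.coe_univ, Set.image_univ, h.range]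
  set X := Finset.univ.image H with hX
  have hsum : ∑ p ∈ X, w p = ∑ p ∈ μ.cells, w p := by
    rw [hX, ← himg, Finset.sum_image (fun _ _ _ _ e => hinj e),
      Finset.sum_image (fun _ _ _ _ e => h.inj e)]
    simp only [w, hH, Finset.sum_sub_distrib]
    rw [Equiv.sum_comp g (fun k => ((T k).2 : ℤ))]
  have hcard : X.card = μ.cells.card := by
    rw [hX, ← himg, Finset.card_image_of_injective _ hinj, Finset.card_image_of_injective _ h.inj]
  have hsub : μ.cells ⊆ X := by
    rw [← Finset.sdiff_eq_empty_iff_subset]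
    by_contra hne
    have h1 : ∑ p ∈ μ.cells \ X, w p < 0 := by
      refine Finset.sum_neg (fun p hp => (hw p).mp (Finset.mem_sdiff.mp hp).1)
        (Finset.nonempty_iff_ne_empty.mpr hne)
    have h2 : 0 ≤ ∑ p ∈ X \ μ.cells, w p := by
      refine Finset.sum_nonneg fun p hp => ?_
      have := (hw p).not.mp (Finset.mem_sdiff.mp hp).2
      omega
    have h3 := Finset.sum_inter_add_sum_sdiff X μ.cells w
    have h4 := Finset.sum_inter_add_sum_sdiff μ.cells X w
    rw [Finset.inter_comm] at h4
    omega
  have : H k ∈ X := Finset.mem_image_of_mem _ (Finset.mem_univ k)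
  rw [← Finset.eq_of_subset_of_card_le hsub hcard.le] at this
  simpa using this

lemma IsFilling.factor (h : IsFilling μ T) (g : Perm (Fin m))
    (hinj : Function.Injective fun k => ((T k).1, (T (g k)).2)) :
    ∃ c ∈ colGroup T, ∃ r ∈ colGroup (Prod.swap ∘ T), g = c * r := by
  choose f hf using fun k => h.exists_eq (h.mem_of_injective g hinj k)
  have hfi : Function.Injective f := fun a b hab => hinj (by
    change ((T a).1, (T (g a)).2) = ((T b).1, (T (g b)).2)
    rw [← hf, ← hf, hab])
  let r : Perm (Fin m) := Equiv.ofBijective f (Finite.injective_iff_bijective.mp hfi)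
  have hr : ∀ k, T (r k) = ((T k).1, (T (g k)).2) := hf
  refine ⟨g * r⁻¹, ?_, r, ?_, by simp⟩
  · rw [mem_colGroup]
    intro k
    have := hr (r⁻¹ k)
    rw [Perm.mul_apply]
    simpa using (congrArg Prod.snd this).symm
  · rw [mem_colGroup]
    intro k
    simp [hr]

/-- Von Neumann's lemma: sandwiching between opposite symmetrizers gives multiples of the
Young symmetrizer. -/
lemma IsFilling.sandwich (h : IsFilling μ T) (s : Bool) (y : SGA m) :
    ∃ c : ℂ, colSym s T * y * colSym (!s) (Prod.swap ∘ T) = c • sym s T := by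
  induction y using MonoidAlgebra.induction_on with
  | of g =>
    change ∃ c : ℂ, colSym s T * sg g * colSym (!s) (Prod.swap ∘ T) = c • sym s T
    by_cases hinj : Function.Injective fun k => ((T k).1, (T (g k)).2)
    · obtain ⟨c, hc, r, hr, rfl⟩ := h.factor g hinj
      refine ⟨chi s c * chi (!s) r, ?_⟩
      rw [← sg_mul, ← mul_assoc, colSym_mul_sg s hc, mul_assoc, sg_mul_colSym _ hr,
        smul_mul_smul_comm, sym]
    · refine ⟨0, ?_⟩
      rw [zero_smul]
      obtain ⟨k, l, hkl, hne⟩ : ∃ k l, ((T k).1, (T (g k)).2) = ((T l).1, (T (g l)).2) ∧ k ≠ l := by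
        simpa [Function.Injective, and_assoc] using hinj
      rw [Prod.mk.injEq] at hkl
      have h1 : swap (g k) (g l) ∈ colGroup T := swap_mem_colGroup hkl.2
      have h2 : swap k l ∈ colGroup (Prod.swap ∘ T) := swap_mem_colGroup hkl.1
      have e1 := colSym_mul_sg s h1
      have e2 := sg_mul_colSym (!s) h2
      rw [chi_swap _ (g.injective.ne hne)] at e1
      rw [chi_swap _ hne, delta_not] at e2
      set A := colSym s T
      set B := colSym (!s) (Prod.swap ∘ T)
      have key : delta s • (A * sg g * B) = -delta s • (A * sg g * B) := by
        calc delta s • (A * sg g * B) = A * sg (swap (g k) (g l)) * sg g * B := by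
              rw [e1, smul_mul_assoc, smul_mul_assoc]
          _ = A * sg g * (sg (swap k l) * B) := by
              rw [mul_assoc A, sg_mul, ← mul_swap_eq_swap_mul, ← sg_mul]
              simp only [mul_assoc]
          _ = _ := by rw [e2, mul_smul_comm]
      rw [neg_smul, eq_neg_iff_add_eq_zero, ← two_smul ℂ, smul_smul] at key
      exact (smul_eq_zero.mp key).resolve_left (mul_ne_zero two_ne_zero (delta_ne_zero s))
  | add x y hx hy =>
    obtain ⟨c, hc⟩ := hx
    obtain ⟨d, hd⟩ := hy
    exact ⟨c + d, by rw [mul_add, add_mul, hc, hd, add_smul]⟩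
  | smul r x hx =>
    obtain ⟨c, hc⟩ := hx
    exact ⟨r * c, by rw [mul_smul_comm, smul_mul_assoc, hc, smul_smul]⟩

lemma sg_mul_sym (s : Bool) (σ : Perm (Fin m)) (T : Fin m → ℕ × ℕ) :
    sg σ * sym s T = ∑ c ∈ colGroup T, ∑ r ∈ colGroup (Prod.swap ∘ T),
      MonoidAlgebra.single (σ * (c * r)) (chi s c * chi (!s) r) := by
  simp only [sym, colSym, Finset.sum_mul_sum]
  rw [Finset.mul_sum]
  refine Finset.sum_congr rfl fun c _ => ?_
  rw [Finset.mul_sum]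
  refine Finset.sum_congr rfl fun r _ => ?_
  simp [MonoidAlgebra.single_mul_single]

/-- The coefficient of a group element in an element of the group algebra. -/
def coeffHom (π : Perm (Fin m)) : SGA m →ₗ[ℂ] ℂ where
  toFun v := v.coeff π
  map_add' _ _ := by simp
  map_smul' _ _ := by simp

lemma coeffHom_single (π σ : Perm (Fin m)) (c : ℂ) :
    coeffHom π (MonoidAlgebra.single σ c) = if σ = π then c else 0 := by
  change (MonoidAlgebra.single σ c).coeff π = _
  simp [Finsupp.single_apply]

lemma coeffHom_sg_mul_sym_eq_zero (s : Bool) (σ π : Perm (Fin m)) (T : Fin m → ℕ × ℕ)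
    (h : ∀ c ∈ colGroup T, ∀ r ∈ colGroup (Prod.swap ∘ T), σ * (c * r) ≠ π) :
    coeffHom π (sg σ * sym s T) = 0 := by
  rw [sg_mul_sym, map_sum]
  refine Finset.sum_eq_zero fun c hc => ?_
  rw [map_sum]
  refine Finset.sum_eq_zero fun r hr => ?_
  rw [coeffHom_single, if_neg (h c hc r hr)]

lemma IsFilling.coeffHom_sg_mul_sym (h : IsFilling μ T) (s : Bool) (σ : Perm (Fin m)) :
    coeffHom σ (sg σ * sym s T) = 1 := by
  have h1 : (1 : Perm (Fin m)) ∈ colGroup T := by simp [mem_colGroup]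
  have h2 : (1 : Perm (Fin m)) ∈ colGroup (Prod.swap ∘ T) := by simp [mem_colGroup]
  rw [sg_mul_sym, map_sum, Finset.sum_eq_single_of_mem 1 h1, map_sum,
    Finset.sum_eq_single_of_mem 1 h2]
  · simp [coeffHom_single]
  · intro r _ hr
    rw [coeffHom_single, if_neg (by simpa using hr)]
  · intro c hc hne
    rw [map_sum]
    refine Finset.sum_eq_zero fun r hr => ?_
    rw [coeffHom_single, if_neg]
    intro e
    exact hne (h.colGroup_inter hc hr (mul_eq_left.mp e)).1

lemma IsFilling.sym_ne_zero (h : IsFilling μ T) (s : Bool) : sym s T ≠ 0 := by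
  intro h0
  have := h.coeffHom_sg_mul_sym s 1
  rw [h0, mul_zero, map_zero] at this
  exact zero_ne_one this

/-- Left ideals of the group algebra with zero square vanish. -/
lemma eq_zero_of_sq_eq_zero (N : Ideal (SGA m)) (h : ∀ x ∈ N, ∀ y ∈ N, x * y = 0) :
    ∀ x ∈ N, x = 0 := by
  obtain ⟨N', hN'⟩ := exists_isCompl N
  intro z hz
  have h1 : (1 : SGA m) ∈ N ⊔ N' := by rw [hN'.sup_eq_top]; trivial
  obtain ⟨e, he, e', he', hsum⟩ := Submodule.mem_sup.mp h1
  have h2 : z * e' = z := by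
    have : z * (e + e') = z := by rw [hsum, mul_one]
    rwa [mul_add, h z hz e he, zero_add] at this
  have h3 : z ∈ N' := by
    rw [← h2]
    exact N'.mul_mem_left z he'
  exact (Submodule.disjoint_def.mp hN'.disjoint) z hz h3

lemma IsFilling.sym_mul_sym (h : IsFilling μ T) (s : Bool) :
    ∃ κ : ℂ, κ ≠ 0 ∧ sym s T * sym s T = κ • sym s T := by
  have key : ∀ y : SGA m, ∃ c : ℂ, sym s T * y * sym s T = c • (sym s T * sym s T) := by
    intro y
    obtain ⟨c, hc⟩ := h.transpose.sandwich (!s) y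
    have e : Prod.swap ∘ Prod.swap ∘ T = T := rfl
    rw [Bool.not_not, e, sym, Bool.not_not, e] at hc
    refine ⟨c, ?_⟩
    calc sym s T * y * sym s T
        = colSym s T * (colSym (!s) (Prod.swap ∘ T) * y * colSym s T) *
            colSym (!s) (Prod.swap ∘ T) := by simp only [sym, mul_assoc]
      _ = _ := by
        rw [hc]
        simp only [sym, mul_smul_comm, smul_mul_assoc, mul_assoc]
  obtain ⟨κ, hκ⟩ := h.sandwich s (colSym (!s) (Prod.swap ∘ T) * colSym s T)
  have hκ' : sym s T * sym s T = κ • sym s T := by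
    rw [← hκ]
    simp only [sym, mul_assoc]
  refine ⟨κ, ?_, hκ'⟩
  rintro rfl
  rw [zero_smul] at hκ'
  refine h.sym_ne_zero s (eq_zero_of_sq_eq_zero (Ideal.span {sym s T}) ?_ _
    (Ideal.subset_span rfl))
  intro x hx y hy
  obtain ⟨a, rfl⟩ := Ideal.mem_span_singleton'.mp hx
  obtain ⟨b, rfl⟩ := Ideal.mem_span_singleton'.mp hy
  obtain ⟨c, hc⟩ := key b
  rw [mul_assoc, ← mul_assoc (sym s T), hc, hκ', smul_zero, mul_zero]

end Symmetrizers
section Garnir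

variable {m : ℕ} {T : Fin m → ℕ × ℕ}

/-- Column equivariance together with the Garnir relations exchanging one entry with a full
column. -/
structure Garnir (s : Bool) (T : Fin m → ℕ × ℕ) (v : SGA m) : Prop where
  equivariant : ∀ τ ∈ colGroup T, sg τ * v = chi s τ • v
  exchange : ∀ (x : Fin m) (j : ℕ), (T x).2 ≠ j →
    (∀ y, (T y).2 = (T x).2 → ∃ b, T b = ((T y).1, j)) →
    ∑ b with (T b).2 = j, sg (swap x b) * v = -delta s • v

/-- The part of the column symmetrizer supported on permutations sending `y` to `x`. -/
def colSymFiber (s : Bool) (T : Fin m → ℕ × ℕ) (x y : Fin m) : SGA m :=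
  ∑ π ∈ colGroup T with π⁻¹ x = y, chi s π • sg π

lemma colSym_eq_sum_fiber (s : Bool) (T : Fin m → ℕ × ℕ) (x : Fin m) :
    colSym s T = ∑ y, colSymFiber s T x y :=
  (Finset.sum_fiberwise _ _ _).symm

lemma colSymFiber_eq_zero (s : Bool) {x y : Fin m} (h : (T y).2 ≠ (T x).2) :
    colSymFiber s T x y = 0 := by
  refine Finset.sum_eq_zero fun π hπ => ?_
  rw [Finset.mem_filter] at hπ
  refine absurd ?_ h
  rw [← hπ.2]
  exact mem_colGroup.mp (colGroup_inv hπ.1) x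

lemma colSymFiber_mul_swap (s : Bool) {x y b b' : Fin m} (hb : (T b).2 = (T b').2)
    (hne : b ≠ b') (hy : y ≠ b) (hy' : y ≠ b') :
    colSymFiber s T x y * sg (swap b b') = delta s • colSymFiber s T x y := by
  have hsw : swap b b' ∈ colGroup T := swap_mem_colGroup hb
  unfold colSymFiber
  rw [Finset.sum_mul, Finset.smul_sum]
  have hmem : ∀ π ∈ colGroup T, π⁻¹ x = y →
      π * swap b b' ∈ colGroup T ∧ (π * swap b b')⁻¹ x = y := by
    intro π h1 h2
    refine ⟨colGroup_mul h1 hsw, ?_⟩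
    rw [mul_inv_rev, Perm.mul_apply, h2, swap_inv, swap_apply_of_ne_of_ne hy hy']
  refine Finset.sum_bij (fun π _ => π * swap b b') ?_ (fun _ _ _ _ h => mul_right_cancel h) ?_ ?_
  · intro π hπ
    rw [Finset.mem_filter] at hπ ⊢
    exact hmem π hπ.1 hπ.2
  · intro π hπ
    rw [Finset.mem_filter] at hπ
    exact ⟨π * swap b b', Finset.mem_filter.mpr (hmem π hπ.1 hπ.2), by simp [mul_assoc]⟩
  · intro π _
    rw [smul_mul_assoc, sg_mul, map_mul, smul_smul, chi_swap s hne, mul_left_comm,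
      delta_mul_self, mul_one]

lemma sum_swap_mul_colSymFiber (s : Bool) (x y : Fin m) (j : ℕ) :
    ∑ b with (T b).2 = j, sg (swap x b) * colSymFiber s T x y =
      colSymFiber s T x y * ∑ b with (T b).2 = j, sg (swap y b) := by
  unfold colSymFiber
  simp only [Finset.mul_sum, Finset.sum_mul]
  rw [Finset.sum_comm]
  conv_rhs => rw [Finset.sum_comm]
  refine Finset.sum_congr rfl fun π hπ => ?_
  rw [Finset.mem_filter] at hπ
  symm
  refine Finset.sum_bij (fun b _ => π b) ?_ (fun _ _ _ _ h => π.injective h) ?_ ?_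
  · intro b hb
    simp only [Finset.mem_filter, Finset.mem_univ, true_and] at hb ⊢
    rw [mem_colGroup.mp hπ.1, hb]
  · intro b hb
    simp only [Finset.mem_filter, Finset.mem_univ, true_and] at hb
    refine ⟨π⁻¹ b, ?_, by simp⟩
    simp only [Finset.mem_filter, Finset.mem_univ, true_and]
    rw [mem_colGroup.mp (colGroup_inv hπ.1), hb]
  · intro b _
    rw [smul_mul_assoc, mul_smul_comm, sg_mul, sg_mul, mul_swap_eq_swap_mul, ← hπ.2]
    simp

lemma colSymFiber_mul_sum (s : Bool) {x y b₀ : Fin m} {j : ℕ}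
    (hj : (T y).2 ≠ j) (hb₀ : T b₀ = ((T y).1, j)) :
    colSymFiber s T x y * (∑ b with (T b).2 = j, sg (swap y b)) *
        colSym (!s) (Prod.swap ∘ T) =
      -delta s • (colSymFiber s T x y * colSym (!s) (Prod.swap ∘ T)) := by
  set P := colSymFiber s T x y with hP
  set a := colSym (!s) (Prod.swap ∘ T) with ha
  have hcol₀ : (T b₀).2 = j := by rw [hb₀]
  have hyb₀ : y ≠ b₀ := by
    rintro rfl
    exact hj hcol₀
  have hrow : sg (swap y b₀) * a = -delta s • a := by
    rw [ha, sg_mul_colSym _ (swap_mem_colGroup (by simp [hb₀])), chi_swap _ hyb₀, delta_not]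
  rw [Finset.mul_sum, Finset.sum_mul,
    Finset.sum_eq_single_of_mem b₀ (by simp [hcol₀]), mul_assoc, hrow, mul_smul_comm]
  intro b hb hne
  have hcol : (T b).2 = j := by simpa using hb
  have hyb : y ≠ b := by
    rintro rfl
    exact hj hcol
  have hperm : swap y b * swap y b₀ = swap b b₀ * swap y b := by
    rw [mul_swap_eq_swap_mul, swap_apply_left, swap_apply_of_ne_of_ne hyb₀.symm hne.symm]
  have key : delta s • (P * sg (swap y b) * a) = -delta s • (P * sg (swap y b) * a) := by
    calc delta s • (P * sg (swap y b) * a) = P * sg (swap b b₀) * sg (swap y b) * a := by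
          rw [hP, colSymFiber_mul_swap s (hcol.trans hcol₀.symm) hne hyb hyb₀,
            smul_mul_assoc, smul_mul_assoc]
      _ = P * sg (swap y b) * (sg (swap y b₀) * a) := by
          rw [mul_assoc P, sg_mul, ← hperm, ← sg_mul]
          simp only [mul_assoc]
      _ = _ := by rw [hrow, mul_smul_comm]
  rw [neg_smul, eq_neg_iff_add_eq_zero, ← two_smul ℂ, smul_smul] at key
  exact (smul_eq_zero.mp key).resolve_left (mul_ne_zero two_ne_zero (delta_ne_zero s))

lemma garnir_sym (s : Bool) (T : Fin m → ℕ × ℕ) : Garnir s T (sym s T) where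
  equivariant τ hτ := by rw [sym, ← mul_assoc, sg_mul_colSym s hτ, smul_mul_assoc]
  exchange x j hj hcol := by
    rw [sym, colSym_eq_sum_fiber s T x, Finset.sum_mul, Finset.smul_sum]
    simp only [Finset.mul_sum]
    rw [Finset.sum_comm]
    refine Finset.sum_congr rfl fun y _ => ?_
    by_cases hy : (T y).2 = (T x).2
    · obtain ⟨b₀, hb₀⟩ := hcol y hy
      rw [← colSymFiber_mul_sum s (hy ▸ hj) hb₀, ← sum_swap_mul_colSymFiber, Finset.sum_mul]
      simp only [mul_assoc]
    · simp [colSymFiber_eq_zero s hy]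

lemma Garnir.mul_right {s : Bool} {v : SGA m} (h : Garnir s T v) (z : SGA m) :
    Garnir s T (v * z) where
  equivariant τ hτ := by rw [← mul_assoc, h.equivariant τ hτ, smul_mul_assoc]
  exchange x j hj hcol := by
    rw [← smul_mul_assoc, ← h.exchange x j hj hcol, Finset.sum_mul]
    simp only [mul_assoc]

lemma Garnir.translate {s : Bool} {v : SGA m} (h : Garnir s T v) (σ : Perm (Fin m)) :
    Garnir s (T ∘ ⇑σ⁻¹) (sg σ * v) where
  equivariant τ hτ := by
    have hτ' : σ⁻¹ * τ * σ ∈ colGroup T := by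
      rw [mem_colGroup] at *
      intro k
      simpa using hτ (σ k)
    have e := h.equivariant _ hτ'
    have e2 : τ * σ = σ * (σ⁻¹ * τ * σ) := by group
    have e3 : chi s (σ⁻¹ * τ * σ) = chi s τ := by
      rw [map_mul, map_mul, mul_right_comm, ← map_mul]
      simp
    rw [sg_mul_mul, e2, ← sg_mul_mul, e, mul_smul_comm, e3]
  exchange x j hj hcol := by
    have e := h.exchange (σ⁻¹ x) j hj (fun y hy => by
      obtain ⟨b, hb⟩ := hcol (σ y) (by simpa using hy)
      exact ⟨σ⁻¹ b, by simpa using hb⟩)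
    rw [← mul_smul_comm, ← e, Finset.mul_sum]
    symm
    refine Finset.sum_bij (fun b _ => σ b) ?_ (fun _ _ _ _ h => σ.injective h) ?_ ?_
    · intro b hb
      simpa using hb
    · intro b hb
      exact ⟨σ⁻¹ b, by simpa using hb, by simp⟩
    · intro b _
      rw [sg_mul_mul, sg_mul_mul, mul_swap_eq_swap_mul]
      simp

end Garnir

section Embedding

variable {n : ℕ}

/-- The embedding of symmetric groups underlying `res`. -/
abbrev emb (σ : Perm (Fin n)) : Perm (Fin (n + 1)) :=
  Perm.viaEmbeddingHom ⟨Fin.castSucc, Fin.castSucc_injective n⟩ σ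

lemma emb_castSucc (σ : Perm (Fin n)) (k : Fin n) : emb σ k.castSucc = (σ k).castSucc :=
  Perm.viaEmbedding_apply σ ⟨Fin.castSucc, Fin.castSucc_injective n⟩ k

lemma emb_last (σ : Perm (Fin n)) : emb σ (Fin.last n) = Fin.last n := by
  refine Perm.viaEmbedding_apply_of_notMem σ ⟨Fin.castSucc, Fin.castSucc_injective n⟩ _ ?_
  rintro ⟨k, hk⟩
  exact (Fin.castSucc_lt_last k).ne hk

lemma emb_inv_last (σ : Perm (Fin n)) : (emb σ)⁻¹ (Fin.last n) = Fin.last n := by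
  rw [Perm.inv_eq_iff_eq, emb_last]

lemma exists_emb_eq {σ : Perm (Fin (n + 1))} (h : σ (Fin.last n) = Fin.last n) :
    ∃ τ, emb τ = σ := by
  have hne : ∀ k : Fin n, σ k.castSucc ≠ Fin.last n := by
    intro k hk
    rw [← h] at hk
    exact (Fin.castSucc_lt_last k).ne (σ.injective hk)
  have hinj : Function.Injective fun k : Fin n => (σ k.castSucc).castPred (hne k) := by
    intro a b hab
    have := Fin.castPred_inj.mp hab
    exact Fin.castSucc_injective n (σ.injective this)
  refine ⟨Equiv.ofBijective _ (Finite.injective_iff_bijective.mp hinj), ?_⟩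
  ext k
  congr 1
  induction k using Fin.lastCases with
  | last => rw [emb_last, h]
  | cast k => simp [emb_castSucc]

lemma res_sg (σ : Perm (Fin n)) : res n (sg σ) = sg (emb σ) := by
  rw [res, MonoidAlgebra.mapDomainRingHom_apply, MonoidAlgebra.mapDomain_single]

lemma res_smul (c : ℂ) (a : SGA n) : res n (c • a) = c • res n a := by
  rw [res, MonoidAlgebra.mapDomainRingHom_apply, MonoidAlgebra.mapDomainRingHom_apply,
    MonoidAlgebra.mapDomain_smul]

lemma chi_emb (s : Bool) (σ : Perm (Fin n)) : chi s (emb σ) = chi s σ := by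
  cases s
  · simp [chi_false]
  · rw [chi_true, chi_true, emb, Perm.viaEmbeddingHom_apply, Perm.viaEmbedding,
      Perm.sign_extendDomain]

lemma JM_mul_res (a : SGA n) : JM n * res n a = res n a * JM n := by
  induction a using MonoidAlgebra.induction_on with
  | of τ =>
    change JM n * res n (sg τ) = res n (sg τ) * JM n
    rw [res_sg, JM, Finset.sum_mul, Finset.mul_sum,
      ← Equiv.sum_comp τ fun i => sg (swap (Fin.castSucc i) (Fin.last n)) * sg (emb τ)]
    refine Finset.sum_congr rfl fun i _ => ?_
    rw [sg_mul, sg_mul, mul_swap_eq_swap_mul, emb_castSucc, emb_last]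
  | add x y hx hy => rw [map_add, mul_add, add_mul, hx, hy]
  | smul r x hx => rw [res_smul, mul_smul_comm, smul_mul_assoc, hx]

end Embedding
section Filtration

variable {n : ℕ} {μ : YoungDiagram} {T : Fin (n + 1) → ℕ × ℕ} {s : Bool} {e v : SGA (n + 1)}

/-- The signed content of the bottom box of column `j`. -/
def colContent (s : Bool) (μ : YoungDiagram) (j : ℕ) : ℂ :=
  delta s * ((μ.colLen j : ℂ) - 1 - j)

lemma colContent_injective (s : Bool) (μ : YoungDiagram) :
    Function.Injective (colContent s μ) := by
  intro a b hab
  have h1 := mul_left_cancel₀ (delta_ne_zero s) hab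
  have h2 : (μ.colLen a : ℤ) - 1 - a = (μ.colLen b : ℤ) - 1 - b := by exact_mod_cast h1
  rcases le_total a b with h | h
  · have := μ.colLen_anti a b h
    omega
  · have := μ.colLen_anti b a h
    omega

lemma IsFilling.JM_mul (hT : IsFilling μ T) (hv : Garnir s T v) :
    JM n * v = colContent s μ (T (Fin.last n)).2 • v +
      ∑ k with (T (Fin.last n)).2 < (T k).2, sg (swap (Fin.last n) k) * v := by
  set J := (T (Fin.last n)).2 with hJ
  set F : Fin (n + 1) → SGA (n + 1) := fun k => sg (swap (Fin.last n) k) * v with hF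
  have hlast : F (Fin.last n) = v := by
    simp only [hF, swap_self]
    exact one_mul v
  have htot : ∑ k, F k = JM n * v + v := by
    rw [Fin.sum_univ_castSucc, hlast, JM, Finset.sum_mul]
    simp only [hF, swap_comm (Fin.last n)]
  have hleft : ∀ j < J, ∑ k with (T k).2 = j, F k = -delta s • v := by
    intro j hj
    refine hv.exchange (Fin.last n) j hj.ne' fun y hy => hT.exists_eq ?_
    exact μ.up_left_mem le_rfl (hj.le.trans hy.ge) (hT.mem y)
  have hsame : ∑ k with (T k).2 = J, F k = v + ((μ.colLen J : ℂ) - 1) • delta s • v := by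
    have hmem : Fin.last n ∈ Finset.univ.filter fun k => (T k).2 = J := by simp [hJ]
    rw [← Finset.add_sum_erase _ _ hmem, hlast]
    congr 1
    rw [Finset.sum_congr rfl (g := fun _ => delta s • v), Finset.sum_const,
      Finset.card_erase_of_mem hmem, hT.card_col, ← Nat.cast_smul_eq_nsmul ℂ, Nat.cast_sub,
      Nat.cast_one]
    · rw [← hT.card_col]
      exact Finset.card_pos.mpr ⟨_, hmem⟩
    · intro k hk
      simp only [Finset.mem_erase, Finset.mem_filter, Finset.mem_univ, true_and] at hk
      change sg (swap (Fin.last n) k) * v = _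
      rw [hv.equivariant _ (swap_mem_colGroup hk.2.symm), chi_swap s (Ne.symm hk.1)]
  have hle : ∑ k with ¬ J < (T k).2, F k =
      ∑ j ∈ Finset.range (J + 1), ∑ k with (T k).2 = j, F k := by
    rw [← Finset.sum_fiberwise_of_maps_to (g := fun k => (T k).2) (t := Finset.range (J + 1))
      (fun k hk => by simp at hk ⊢; omega)]
    refine Finset.sum_congr rfl fun j hj => ?_
    rw [Finset.filter_filter]
    refine Finset.sum_congr (Finset.filter_congr fun k _ => ?_) fun _ _ => rfl
    have := Finset.mem_range.mp hj
    omega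
  have hsplit := Finset.sum_filter_add_sum_filter_not Finset.univ (fun k => J < (T k).2) F
  rw [hle, Finset.sum_range_succ, hsame,
    Finset.sum_congr rfl (fun j hj => hleft j (Finset.mem_range.mp hj)), Finset.sum_const,
    Finset.card_range, htot, ← Nat.cast_smul_eq_nsmul ℂ] at hsplit
  rw [← add_right_cancel_iff (a := v), ← hsplit, colContent]
  module

/-- The span of the translates of `e` for which the last letter lies in column `≥ j`. -/
def filt (T : Fin (n + 1) → ℕ × ℕ) (e : SGA (n + 1)) (j : ℕ) : Submodule ℂ (SGA (n + 1)) :=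
  Submodule.span ℂ {v | ∃ σ : Perm (Fin (n + 1)), j ≤ (T (σ⁻¹ (Fin.last n))).2 ∧ v = sg σ * e}

lemma sg_mul_mem_filt {j : ℕ} {σ : Perm (Fin (n + 1))} (h : j ≤ (T (σ⁻¹ (Fin.last n))).2) :
    sg σ * e ∈ filt T e j :=
  Submodule.subset_span ⟨σ, h, rfl⟩

lemma filt_anti : Antitone (filt T e) := by
  intro i j hij
  refine Submodule.span_mono ?_
  rintro v ⟨σ, hσ, rfl⟩
  exact ⟨σ, hij.trans hσ, rfl⟩

lemma mem_filt_zero : v ∈ filt T e 0 ↔ ∃ a, v = a * e := by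
  constructor
  · intro hv
    induction hv using Submodule.span_induction with
    | mem x hx =>
      obtain ⟨σ, -, rfl⟩ := hx
      exact ⟨_, rfl⟩
    | zero => exact ⟨0, by simp⟩
    | add x y _ _ hx hy =>
      obtain ⟨a, rfl⟩ := hx
      obtain ⟨b, rfl⟩ := hy
      exact ⟨a + b, by rw [add_mul]⟩
    | smul c x _ hx =>
      obtain ⟨a, rfl⟩ := hx
      exact ⟨c • a, by rw [smul_mul_assoc]⟩
  · rintro ⟨a, rfl⟩
    induction a using MonoidAlgebra.induction_on with
    | of σ => exact sg_mul_mem_filt (Nat.zero_le _)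
    | add x y hx hy =>
      rw [add_mul]
      exact add_mem hx hy
    | smul r x hx =>
      rw [smul_mul_assoc]
      exact Submodule.smul_mem _ _ hx

lemma exists_filt_eq_bot (T : Fin (n + 1) → ℕ × ℕ) (e : SGA (n + 1)) : ∃ N, filt T e N = ⊥ := by
  refine ⟨(Finset.univ.sup fun k => (T k).2) + 1, ?_⟩
  rw [eq_bot_iff, filt, Submodule.span_le]
  rintro v ⟨σ, hσ, rfl⟩
  have : (T (σ⁻¹ (Fin.last n))).2 ≤ Finset.univ.sup fun k => (T k).2 :=
    Finset.le_sup (f := fun k => (T k).2) (Finset.mem_univ _)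
  omega

lemma res_mul_mem_filt {j : ℕ} (a : SGA n) (hv : v ∈ filt T e j) : res n a * v ∈ filt T e j := by
  induction a using MonoidAlgebra.induction_on with
  | of τ =>
    change res n (sg τ) * v ∈ _
    rw [res_sg]
    induction hv using Submodule.span_induction with
    | mem x hx =>
      obtain ⟨σ, hσ, rfl⟩ := hx
      rw [sg_mul_mul]
      refine sg_mul_mem_filt ?_
      rwa [mul_inv_rev, Perm.mul_apply, emb_inv_last]
    | zero => simp
    | add x y _ _ hx hy =>
      rw [mul_add]
      exact add_mem hx hy
    | smul c x _ hx =>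
      rw [mul_smul_comm]
      exact Submodule.smul_mem _ _ hx
  | add x y hx hy =>
    rw [map_add, add_mul]
    exact add_mem hx hy
  | smul r x hx =>
    rw [res_smul, smul_mul_assoc]
    exact Submodule.smul_mem _ _ hx

lemma swap_mul_mem_filt {j : ℕ} {σ : Perm (Fin (n + 1))} {k : Fin (n + 1)}
    (h : j ≤ (T (σ⁻¹ k)).2) : sg (swap (Fin.last n) k) * (sg σ * e) ∈ filt T e j := by
  rw [sg_mul_mul]
  refine sg_mul_mem_filt ?_
  rwa [mul_inv_rev, Perm.mul_apply, swap_inv, swap_apply_left]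

lemma IsFilling.JM_sub_generator (hT : IsFilling μ T) (he : Garnir s T e)
    (σ : Perm (Fin (n + 1))) :
    JM n * (sg σ * e) - colContent s μ (T (σ⁻¹ (Fin.last n))).2 • (sg σ * e) ∈
      filt T e ((T (σ⁻¹ (Fin.last n))).2 + 1) := by
  rw [(hT.comp σ⁻¹).JM_mul (he.translate σ)]
  simp only [Function.comp, add_sub_cancel_left]
  refine Submodule.sum_mem _ fun k hk => swap_mul_mem_filt ?_
  simpa using hk

lemma IsFilling.JM_mul_mem (hT : IsFilling μ T) (he : Garnir s T e) {j : ℕ}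
    (hv : v ∈ filt T e j) : JM n * v ∈ filt T e j := by
  induction hv using Submodule.span_induction with
  | mem x hx =>
    obtain ⟨σ, hσ, rfl⟩ := hx
    have h1 := filt_anti (hσ.trans (Nat.le_succ _)) (hT.JM_sub_generator he σ)
    have h2 := Submodule.smul_mem _ (colContent s μ (T (σ⁻¹ (Fin.last n))).2)
      (sg_mul_mem_filt (e := e) hσ)
    simpa using add_mem h1 h2
  | zero => simp
  | add x y _ _ hx hy =>
    rw [mul_add]
    exact add_mem hx hy
  | smul c x _ hx =>
    rw [mul_smul_comm]
    exact Submodule.smul_mem _ _ hx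

lemma IsFilling.JM_sub_mem (hT : IsFilling μ T) (he : Garnir s T e) {j : ℕ}
    (hv : v ∈ filt T e j) : JM n * v - colContent s μ j • v ∈ filt T e (j + 1) := by
  induction hv using Submodule.span_induction with
  | mem x hx =>
    obtain ⟨σ, hσ, rfl⟩ := hx
    rcases hσ.eq_or_lt with h | h
    · rw [h]
      exact hT.JM_sub_generator he σ
    · have h1 := sg_mul_mem_filt (e := e) (Nat.succ_le_of_lt h)
      exact sub_mem (hT.JM_mul_mem he h1) (Submodule.smul_mem _ _ h1)
  | zero => simp
  | add x y _ _ hx hy =>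
    have := add_mem hx hy
    rw [mul_add, smul_add]
    convert this using 1
    abel
  | smul c x _ hx =>
    rw [mul_smul_comm, smul_comm, ← smul_sub]
    exact Submodule.smul_mem _ _ hx

lemma IsFilling.filt_le_succ (hT : IsFilling μ T) (he : Garnir s T e) {j : ℕ}
    (hj : μ.colLen (j + 1) = μ.colLen j) : filt T e j ≤ filt T e (j + 1) := by
  refine Submodule.span_le.mpr ?_
  rintro v ⟨σ, hσ, rfl⟩
  rcases hσ.eq_or_lt with h | h
  · have key := (he.translate σ).exchange (Fin.last n) (j + 1)
      (by change (T (σ⁻¹ (Fin.last n))).2 ≠ j + 1; omega) (fun y hy => by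
      refine (hT.comp σ⁻¹).exists_eq ?_
      have hm := (hT.comp σ⁻¹).mem y
      have hy' : ((T ∘ ⇑σ⁻¹) y).2 = j := by rw [hy, h]; rfl
      rw [← Prod.mk.eta (p := (T ∘ ⇑σ⁻¹) y), hy', YoungDiagram.mem_iff_lt_colLen] at hm
      rwa [YoungDiagram.mem_iff_lt_colLen, hj])
    have hmem : -delta s • (sg σ * e) ∈ filt T e (j + 1) := by
      rw [← key]
      refine Submodule.sum_mem _ fun k hk => swap_mul_mem_filt ?_
      exact (Finset.mem_filter.mp hk).2.ge
    exact (Submodule.smul_mem_iff _ (neg_ne_zero.mpr (delta_ne_zero s))).mp hmem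
  · exact sg_mul_mem_filt h

lemma IsFilling.eigen_mem_succ (hT : IsFilling μ T) (he : Garnir s T e) {j : ℕ} {c : ℂ}
    (hv : v ∈ filt T e j) (hc : JM n * v = c • v) (hne : c ≠ colContent s μ j) :
    v ∈ filt T e (j + 1) := by
  have h := hT.JM_sub_mem he hv
  rw [hc, ← sub_smul] at h
  exact (Submodule.smul_mem_iff _ (sub_ne_zero.mpr hne)).mp h

lemma IsFilling.eigen_mem (hT : IsFilling μ T) (he : Garnir s T e) {j : ℕ}
    (hv : v ∈ filt T e 0) (hc : JM n * v = colContent s μ j • v) : v ∈ filt T e j := by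
  have : ∀ i ≤ j, v ∈ filt T e i := by
    intro i
    induction i with
    | zero => exact fun _ => hv
    | succ i ih =>
      intro hi
      exact hT.eigen_mem_succ he (ih (by omega)) hc
        ((colContent_injective s μ).ne (by omega))
  exact this j le_rfl

lemma IsFilling.eigen_eq_zero (hT : IsFilling μ T) (he : Garnir s T e) {j : ℕ}
    (hv : v ∈ filt T e (j + 1)) (hc : JM n * v = colContent s μ j • v) : v = 0 := by
  have : ∀ i, v ∈ filt T e (j + 1 + i) := by
    intro i
    induction i with
    | zero => exact hv
    | succ i ih =>
      exact hT.eigen_mem_succ (j := j + 1 + i) he ih hc ((colContent_injective s μ).ne (by omega))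
  obtain ⟨N, hN⟩ := exists_filt_eq_bot T e
  have h := filt_anti (show N ≤ j + 1 + N by omega) (this N)
  rwa [hN, Submodule.mem_bot] at h

lemma IsFilling.exists_eigen (hT : IsFilling μ T) (he : Garnir s T e) {j : ℕ}
    (hv : v ∈ filt T e j) :
    ∃ u ∈ filt T e (j + 1), JM n * (v - u) = colContent s μ j • (v - u) := by
  let f : SGA (n + 1) →ₗ[ℂ] SGA (n + 1) :=
    LinearMap.mulLeft ℂ (JM n) - colContent s μ j • LinearMap.id
  have hf : ∀ x, f x = JM n * x - colContent s μ j • x := fun x => by simp [f]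
  have hst : ∀ x ∈ filt T e (j + 1), f x ∈ filt T e (j + 1) := fun x hx => by
    rw [hf]
    exact sub_mem (hT.JM_mul_mem he hx) (Submodule.smul_mem _ _ hx)
  have hsurj : Function.Surjective (f.restrict hst) := by
    rw [← LinearMap.injective_iff_surjective, ← LinearMap.ker_eq_bot, LinearMap.ker_eq_bot']
    rintro ⟨x, hx⟩ h0
    have h1 : f x = 0 := congrArg Subtype.val h0
    rw [hf, sub_eq_zero] at h1
    exact Subtype.ext (hT.eigen_eq_zero he hx h1)
  obtain ⟨⟨u, hu⟩, hu'⟩ := hsurj ⟨f v, by rw [hf]; exact hT.JM_sub_mem he hv⟩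
  have h1 : f u = f v := congrArg Subtype.val hu'
  refine ⟨u, hu, ?_⟩
  rw [← sub_eq_zero, ← hf, map_sub, h1, sub_self]

lemma IsFilling.filt_le_of_eigen (hT : IsFilling μ T) (he : Garnir s T e)
    (P : Submodule ℂ (SGA (n + 1)))
    (hP : ∀ j, μ.colLen (j + 1) < μ.colLen j → ∀ v ∈ filt T e 0,
      JM n * v = colContent s μ j • v → v ∈ P) :
    filt T e 0 ≤ P := by
  obtain ⟨N, hN⟩ := exists_filt_eq_bot T e
  have key : ∀ d j, N ≤ j + d → filt T e j ≤ P := by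
    intro d
    induction d with
    | zero =>
      intro j hj
      exact (filt_anti (by omega)).trans (hN.le.trans bot_le)
    | succ d ih =>
      intro j hj
      have hnext := ih (j + 1) (by omega)
      rcases (μ.colLen_anti j (j + 1) (by omega)).eq_or_lt with h | h
      · exact (hT.filt_le_succ he h).trans hnext
      · intro v hv
        obtain ⟨u, hu, huv⟩ := hT.exists_eigen he hv
        have hmem : v - u ∈ filt T e j := sub_mem hv (filt_anti (by omega) hu)
        have := hP j h (v - u) (filt_anti (Nat.zero_le j) hmem) huv
        simpa using add_mem this (hnext hu)
  exact key N 0 (by omega)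

lemma Garnir.exists_res_mul_sub_mem (he : Garnir s T e) {σ₀ : Perm (Fin (n + 1))}
    (hv : v ∈ filt T e (T (σ₀⁻¹ (Fin.last n))).2) :
    ∃ a : SGA n, v - res n a * (sg σ₀ * e) ∈ filt T e ((T (σ₀⁻¹ (Fin.last n))).2 + 1) := by
  induction hv using Submodule.span_induction with
  | mem x hx =>
    obtain ⟨σ, hσ, rfl⟩ := hx
    rcases hσ.eq_or_lt with h | h
    · set k := σ (σ₀⁻¹ (Fin.last n)) with hk
      have hfix : (swap (Fin.last n) k * σ * σ₀⁻¹) (Fin.last n) = Fin.last n := by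
        simp [hk]
      obtain ⟨τ, hτ⟩ := exists_emb_eq hfix
      have hmem : swap (Fin.last n) k ∈ colGroup (T ∘ ⇑σ⁻¹) :=
        swap_mem_colGroup (by simpa [hk] using h.symm)
      have heq := (he.translate σ).equivariant _ hmem
      refine ⟨chi s (swap (Fin.last n) k) • sg τ, ?_⟩
      have : sg (emb τ) * (sg σ₀ * e) = sg (swap (Fin.last n) k) * (sg σ * e) := by
        rw [hτ, sg_mul_mul, sg_mul_mul]
        simp [mul_assoc]
      rw [res_smul, res_sg, smul_mul_assoc, this, heq, smul_smul, chi_mul_self, one_smul,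
        sub_self]
      exact zero_mem _
    · exact ⟨0, by simpa using sg_mul_mem_filt (e := e) (Nat.succ_le_of_lt h)⟩
  | zero => exact ⟨0, by simp⟩
  | add x y _ _ hx hy =>
    obtain ⟨a, ha⟩ := hx
    obtain ⟨b, hb⟩ := hy
    refine ⟨a + b, ?_⟩
    have := add_mem ha hb
    rw [map_add, add_mul]
    convert this using 1
    abel
  | smul c x _ hx =>
    obtain ⟨a, ha⟩ := hx
    refine ⟨c • a, ?_⟩
    rw [res_smul, smul_mul_assoc, ← smul_sub]
    exact Submodule.smul_mem _ _ ha

/-- Each eigenspace of the Jucys-Murphy element is cyclic over the smaller symmetric group,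
generated by a column-equivariant vector. -/
lemma IsFilling.exists_cyclic (hT : IsFilling μ T) (he : Garnir s T e)
    (σ₀ : Perm (Fin (n + 1))) {j : ℕ} (hj : (T (σ₀⁻¹ (Fin.last n))).2 = j) :
    ∃ w ∈ filt T e 0, JM n * w = colContent s μ j • w ∧
      (∀ τ ∈ colGroup (fun k : Fin n => T (σ₀⁻¹ k.castSucc)),
        res n (sg τ) * w = chi s τ • w) ∧
      ∀ v ∈ filt T e 0, JM n * v = colContent s μ j • v → ∃ a : SGA n, v = res n a * w := by
  subst hj
  set j := (T (σ₀⁻¹ (Fin.last n))).2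
  set g := sg σ₀ * e with hg
  have hgj : g ∈ filt T e j := sg_mul_mem_filt le_rfl
  obtain ⟨u, hu, hw⟩ := hT.exists_eigen he hgj
  have hcomm : ∀ a : SGA n, JM n * (res n a * (g - u)) =
      colContent s μ j • (res n a * (g - u)) := fun a => by
    rw [← mul_assoc, JM_mul_res, mul_assoc, hw, mul_smul_comm]
  refine ⟨g - u, filt_anti (Nat.zero_le j) (sub_mem hgj (filt_anti (Nat.le_succ j) hu)), hw,
    ?_, ?_⟩
  · intro τ hτ
    have hτ' : emb τ ∈ colGroup (T ∘ ⇑σ₀⁻¹) := by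
      rw [mem_colGroup] at *
      intro k
      induction k using Fin.lastCases with
      | last => rw [emb_last]
      | cast k =>
        rw [emb_castSucc]
        exact hτ k
    have heq := (he.translate σ₀).equivariant _ hτ'
    rw [chi_emb] at heq
    rw [← sub_eq_zero]
    refine hT.eigen_eq_zero (j := j) he ?_ ?_
    · have : res n (sg τ) * (g - u) - chi s τ • (g - u) =
          chi s τ • u - res n (sg τ) * u := by
        rw [mul_sub, res_sg, heq, smul_sub]
        abel
      rw [this]
      exact sub_mem (Submodule.smul_mem _ _ hu) (res_mul_mem_filt _ hu)
    · rw [mul_sub, hcomm, mul_smul_comm, hw]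
      module
  · intro v hv hvc
    obtain ⟨a, ha⟩ := he.exists_res_mul_sub_mem (hT.eigen_mem he hv hvc)
    refine ⟨a, ?_⟩
    rw [← sub_eq_zero]
    refine hT.eigen_eq_zero (j := j) he ?_ ?_
    · have : v - res n a * (g - u) = (v - res n a * g) + res n a * u := by
        rw [mul_sub]
        abel
      rw [this]
      exact add_mem ha (res_mul_mem_filt _ hu)
    · rw [mul_sub, hcomm, hvc, smul_sub]

lemma IsFilling.exists_eigen_ne_zero (hT : IsFilling μ T) (s : Bool) {j : ℕ}
    (hj : μ.colLen (j + 1) < μ.colLen j) :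
    ∃ w ∈ filt T (sym s T) 0, w ≠ 0 ∧ JM n * w = colContent s μ j • w := by
  have he := garnir_sym s T
  have hbox : (μ.colLen (j + 1), j) ∈ μ := by
    rw [YoungDiagram.mem_iff_lt_colLen]
    exact hj
  obtain ⟨k, hk⟩ := hT.exists_eq hbox
  set σ₀ : Perm (Fin (n + 1)) := swap k (Fin.last n)
  have hσ₀ : T (σ₀⁻¹ (Fin.last n)) = (μ.colLen (j + 1), j) := by simp [σ₀, hk]
  have hg : sg σ₀ * sym s T ∈ filt T (sym s T) j := sg_mul_mem_filt (by rw [hσ₀])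
  obtain ⟨u, hu, hw⟩ := hT.exists_eigen he hg
  refine ⟨_, filt_anti (Nat.zero_le j) (sub_mem hg (filt_anti (Nat.le_succ j) hu)), ?_, hw⟩
  intro h0
  rw [sub_eq_zero] at h0
  have hzero : ∀ x ∈ filt T (sym s T) (j + 1), coeffHom σ₀ x = 0 := by
    intro x hx
    induction hx using Submodule.span_induction with
    | mem x hx =>
      obtain ⟨σ, hσ, rfl⟩ := hx
      refine coeffHom_sg_mul_sym_eq_zero s σ σ₀ T fun c hc r hr heq => ?_
      have h1 : c⁻¹ (σ⁻¹ (Fin.last n)) = r (σ₀⁻¹ (Fin.last n)) := by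
        rw [← heq]
        simp
      have h2 := mem_colGroup.mp hr (σ₀⁻¹ (Fin.last n))
      have h3 := mem_colGroup.mp (colGroup_inv hc) (σ⁻¹ (Fin.last n))
      simp only [Function.comp, Prod.snd_swap, hσ₀] at h2
      rw [h1] at h3
      have h4 := hT.mem (r (σ₀⁻¹ (Fin.last n)))
      rw [← Prod.mk.eta (p := T _), h2, h3] at h4
      have h5 := μ.up_left_mem le_rfl hσ h4
      rw [YoungDiagram.mem_iff_lt_colLen] at h5
      exact lt_irrefl _ h5
    | zero => simp
    | add x y _ _ hx hy => rw [map_add, hx, hy, add_zero]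
    | smul c x _ hx => rw [map_smul, hx, smul_zero]
  have h1 := hT.coeffHom_sg_mul_sym s σ₀
  rw [h0, hzero u hu] at h1
  exact zero_ne_one h1

end Filtration
section Isomorphism

variable {n : ℕ} {ν : YoungDiagram} {T : Fin n → ℕ × ℕ}

lemma mem_specht {m : ℕ} {T : Fin m → ℕ × ℕ} {v : SGA m} :
    v ∈ specht T ↔ ∃ a, v = a * youngSym T := by
  rw [specht, Submodule.restrictScalars_mem, Ideal.mem_span_singleton']
  exact exists_congr fun a => eq_comm

lemma res_colSym_mul (s : Bool) (T : Fin n → ℕ × ℕ) {v : SGA (n + 1)}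
    (h : ∀ τ ∈ colGroup T, res n (sg τ) * v = chi s τ • v) :
    res n (colSym s T) * v = ((colGroup T).card : ℂ) • v := by
  rw [← sum_smul_of_equivariant s T (fun τ => res n (sg τ) * v) v h, colSym, map_sum,
    Finset.sum_mul]
  refine Finset.sum_congr rfl fun τ _ => ?_
  rw [res_smul, smul_mul_assoc]

/-- A nonzero module generated both by a column-antisymmetric and by a row-symmetric vector
is isomorphic to the Specht module. -/
lemma IsFilling.exists_linearEquiv (hT : IsFilling ν T) (W : Submodule ℂ (SGA (n + 1)))
    (hinv : ∀ (a : SGA n) (v : SGA (n + 1)), v ∈ W → res n a * v ∈ W) (hW : W ≠ ⊥)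
    {w u : SGA (n + 1)} (hw : w ∈ W) (hu : u ∈ W)
    (hwcol : ∀ τ ∈ colGroup T, res n (sg τ) * w = chi true τ • w)
    (hurow : ∀ τ ∈ colGroup (Prod.swap ∘ T), res n (sg τ) * u = chi false τ • u)
    (hwgen : ∀ v ∈ W, ∃ a : SGA n, v = res n a * w)
    (hugen : ∀ v ∈ W, ∃ a : SGA n, v = res n a * u) :
    ∃ e : W ≃ₗ[ℂ] specht T, ∀ (a : SGA n) (v : SGA (n + 1)) (hv : v ∈ W),
      (e ⟨res n a * v, hinv a v hv⟩ : SGA n) = a * (e ⟨v, hv⟩ : SGA n) := by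
  set A := colSym false (Prod.swap ∘ T)
  set B := colSym true T
  have hY : youngSym T = A * B := youngSym_eq_sym T
  have hsand : ∀ z, ∃ c : ℂ, A * z * B = c • (A * B) := hT.transpose.sandwich false
  have hAu := res_colSym_mul false _ hurow
  have hBw := res_colSym_mul true _ hwcol
  have hu0 : u ≠ 0 := by
    rintro rfl
    refine hW (eq_bot_iff.mpr fun v hv => ?_)
    obtain ⟨a, rfl⟩ := hugen v hv
    simp
  obtain ⟨d, hd⟩ : ∃ d : ℂ, u = d • (res n (youngSym T) * w) := by
    obtain ⟨z, hz⟩ := hwgen u hu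
    obtain ⟨c, hc⟩ := hsand z
    have key : (((colGroup (Prod.swap ∘ T)).card : ℂ) * ((colGroup T).card : ℂ)) • u =
        c • (res n (youngSym T) * w) := by
      calc _ = res n A * (res n z * (((colGroup T).card : ℂ) • w)) := by
            rw [mul_smul_comm, mul_smul_comm, ← hz, hAu, smul_smul, mul_comm]
        _ = res n (A * z * B) * w := by
            rw [← hBw]
            simp only [map_mul, mul_assoc, B]
        _ = _ := by rw [hc, res_smul, smul_mul_assoc, hY]
    have hne := mul_ne_zero (card_colGroup_ne_zero (Prod.swap ∘ T)) (card_colGroup_ne_zero T)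
    exact ⟨_, by rw [mul_smul, ← key, inv_smul_smul₀ hne]⟩
  have hYw : res n (youngSym T) * w ≠ 0 := by
    intro h0
    rw [h0, smul_zero] at hd
    exact hu0 hd
  let ψ₀ : SGA n →ₗ[ℂ] W :=
    { toFun := fun a => ⟨res n a * w, hinv a w hw⟩
      map_add' := fun a b => Subtype.ext (by simp [add_mul])
      map_smul' := fun c a => Subtype.ext (by simp [res_smul]) }
  let ψ : specht T →ₗ[ℂ] W := ψ₀.domRestrict (specht T)
  have hψ : ∀ z, ((ψ z : W) : SGA (n + 1)) = res n (z : SGA n) * w := fun _ => rfl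
  have hinj : Function.Injective ψ := by
    rw [← LinearMap.ker_eq_bot, LinearMap.ker_eq_bot']
    let N : Ideal (SGA n) :=
      { carrier := {z | z ∈ Ideal.span {youngSym T} ∧ res n z * w = 0}
        add_mem' := fun {a b} ha hb =>
          ⟨add_mem ha.1 hb.1, by rw [map_add, add_mul, ha.2, hb.2, add_zero]⟩
        zero_mem' := ⟨zero_mem _, by simp⟩
        smul_mem' := fun c x hx => ⟨Ideal.mul_mem_left _ c hx.1, by
          rw [smul_eq_mul, map_mul, mul_assoc, hx.2, mul_zero]⟩ }
    have hN : ∀ x ∈ N, ∀ y ∈ N, x * y = 0 := by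
      rintro x ⟨hx, -⟩ y ⟨hy, hyw⟩
      obtain ⟨a, rfl⟩ := Ideal.mem_span_singleton'.mp hx
      obtain ⟨b, hb⟩ := Ideal.mem_span_singleton'.mp hy
      obtain ⟨c, hc⟩ := hsand (B * b * A)
      have hc' : youngSym T * y = c • youngSym T := by
        rw [← hb, hY, ← hc]
        simp only [mul_assoc]
      have hc0 : c • (res n (youngSym T) * w) = 0 := by
        rw [← smul_mul_assoc, ← res_smul, ← hc', map_mul, mul_assoc, hyw, mul_zero]
      rw [mul_assoc, hc', (smul_eq_zero.mp hc0).resolve_right hYw, zero_smul, mul_zero]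
    rintro ⟨z, hz⟩ h0
    refine Subtype.ext (eq_zero_of_sq_eq_zero N hN z ⟨hz, ?_⟩)
    rw [← hψ ⟨z, hz⟩, h0]
    rfl
  have hsurj : Function.Surjective ψ := by
    rintro ⟨v, hv⟩
    obtain ⟨a, rfl⟩ := hugen v hv
    refine ⟨⟨(d • a) * youngSym T, mem_specht.mpr ⟨_, rfl⟩⟩, Subtype.ext ?_⟩
    rw [hψ]
    change res n (d • a * youngSym T) * w = res n a * u
    rw [hd, map_mul, res_smul, smul_mul_assoc, smul_mul_assoc, mul_smul_comm, mul_assoc]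
  let e := LinearEquiv.ofBijective ψ ⟨hinj, hsurj⟩
  refine ⟨e.symm, fun a v hv => ?_⟩
  obtain ⟨z, hz⟩ := hsurj ⟨v, hv⟩
  have h1 : e.symm ⟨v, hv⟩ = z := by
    rw [LinearEquiv.symm_apply_eq]
    exact hz.symm
  have hmem : a * (z : SGA n) ∈ specht T := Ideal.mul_mem_left _ a z.2
  have h2 : e.symm ⟨res n a * v, hinv a v hv⟩ = ⟨a * z, hmem⟩ := by
    rw [LinearEquiv.symm_apply_eq]
    refine Subtype.ext ?_
    change res n a * v = res n (a * z) * w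
    rw [map_mul, mul_assoc, ← hψ, hz]
  rw [h1, h2]

end Isomorphism

section Boxes

variable {lam : YoungDiagram}

lemma mem_removable_iff {x : ℕ × ℕ} :
    x ∈ Removable lam ↔ x ∈ lam ∧ (x.1 + 1, x.2) ∉ lam ∧ (x.1, x.2 + 1) ∉ lam := by
  obtain ⟨i, j⟩ := x
  constructor
  · rintro ⟨hx, ν, hν⟩
    have hnot : (i, j) ∉ ν := by
      rw [← YoungDiagram.mem_cells, hν]
      simp
    have hmem : ∀ y ∈ lam, y ≠ (i, j) → y ∈ ν := fun y hy hne => by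
      rw [← YoungDiagram.mem_cells, hν]
      exact Finset.mem_erase.mpr ⟨hne, hy⟩
    refine ⟨hx, fun h => hnot ?_, fun h => hnot ?_⟩
    · exact ν.up_left_mem (Nat.le_succ i) le_rfl (hmem _ h (by simp))
    · exact ν.up_left_mem le_rfl (Nat.le_succ j) (hmem _ h (by simp))
  · rintro ⟨hx, h1, h2⟩
    refine ⟨hx, ⟨lam.cells.erase (i, j), ?_⟩, rfl⟩
    rintro ⟨a, b⟩ ⟨c, d⟩ hle hmem
    simp only [Finset.coe_erase, Set.mem_sdiff, Finset.mem_coe, YoungDiagram.mem_cells,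
      Set.mem_singleton_iff] at hmem ⊢
    rw [Prod.mk_le_mk] at hle
    refine ⟨lam.up_left_mem hle.1 hle.2 hmem.1, fun heq => ?_⟩
    rw [Prod.mk.injEq] at heq
    obtain ⟨rfl, rfl⟩ := heq
    rcases hle.1.eq_or_lt with h | h
    · rcases hle.2.eq_or_lt with h' | h'
      · exact hmem.2 (by rw [h, h'])
      · exact h2 (lam.up_left_mem hle.1 h' hmem.1)
    · exact h1 (lam.up_left_mem h hle.2 hmem.1)

lemma colLen_of_removable {x : ℕ × ℕ} (hx : x ∈ Removable lam) : lam.colLen x.2 = x.1 + 1 := by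
  obtain ⟨h, h1, -⟩ := mem_removable_iff.mp hx
  have h' : x.1 < lam.colLen x.2 := YoungDiagram.mem_iff_lt_colLen.mp h
  rw [YoungDiagram.mem_iff_lt_colLen] at h1
  omega

lemma colLen_succ_of_removable {x : ℕ × ℕ} (hx : x ∈ Removable lam) :
    lam.colLen (x.2 + 1) < lam.colLen x.2 := by
  obtain ⟨-, -, h2⟩ := mem_removable_iff.mp hx
  rw [YoungDiagram.mem_iff_lt_colLen] at h2
  rw [colLen_of_removable hx]
  omega

lemma swap_mem_removable {x : ℕ × ℕ} (hx : x ∈ Removable lam) :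
    x.swap ∈ Removable lam.transpose := by
  obtain ⟨h, h1, h2⟩ := mem_removable_iff.mp hx
  exact mem_removable_iff.mpr ⟨by simpa using h, by simpa using h2, by simpa using h1⟩

lemma mem_removable_of_corner {j : ℕ} (hj : lam.colLen (j + 1) < lam.colLen j) :
    (lam.colLen j - 1, j) ∈ Removable lam := by
  rw [mem_removable_iff, YoungDiagram.mem_iff_lt_colLen, YoungDiagram.mem_iff_lt_colLen,
    YoungDiagram.mem_iff_lt_colLen]
  dsimp only
  omega

/-- The content of a box. -/
def content (x : ℕ × ℕ) : ℂ := ((((x.2 : ℤ) - (x.1 : ℤ)) : ℤ) : ℂ)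

lemma colContent_true {x : ℕ × ℕ} (hx : x ∈ Removable lam) :
    colContent true lam x.2 = content x := by
  simp only [colContent, colLen_of_removable hx, content, delta, if_true]
  push_cast
  ring

lemma colContent_false {x : ℕ × ℕ} (hx : x ∈ Removable lam) :
    colContent false lam.transpose x.1 = content x := by
  have h := colLen_of_removable (swap_mem_removable hx)
  rw [Prod.snd_swap, Prod.fst_swap] at h
  rw [colContent, h, content, delta]
  push_cast
  ring

lemma content_injOn : Set.InjOn content (Removable lam) := by
  intro x hx y hy hxy
  rw [← colContent_true hx, ← colContent_true hy] at hxy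
  have h2 := colContent_injective true lam hxy
  have h1 := colLen_of_removable hx
  rw [h2, colLen_of_removable hy] at h1
  exact Prod.ext (by omega) h2

end Boxes

section Models

variable {m : ℕ}

/-- The column-antisymmetric generator of the Specht module. -/
def colGen (T : Fin m → ℕ × ℕ) : SGA m := sym true T * colSym true T

lemma colGen_eq (T : Fin m → ℕ × ℕ) : colGen T = colSym true T * youngSym T := by
  have e : Prod.swap ∘ Prod.swap ∘ T = T := rfl
  rw [colGen, youngSym_eq_sym, sym, sym, e, mul_assoc]
  rfl

lemma specht_eq_filt_row {n : ℕ} (T : Fin (n + 1) → ℕ × ℕ) :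
    filt (Prod.swap ∘ T) (sym false (Prod.swap ∘ T)) 0 = specht T := by
  ext v
  rw [mem_filt_zero, mem_specht, youngSym_eq_sym]

lemma IsFilling.specht_eq_filt_col {n : ℕ} {μ : YoungDiagram} {T : Fin (n + 1) → ℕ × ℕ}
    (hT : IsFilling μ T) : filt T (colGen T) 0 = specht T := by
  obtain ⟨κ, hκ, h⟩ := hT.transpose.sym_mul_sym false
  rw [← youngSym_eq_sym] at h
  have h' : colSym false (Prod.swap ∘ T) * colGen T = κ • youngSym T := by
    rw [← h, colGen_eq, ← mul_assoc]
    congr 1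
    rw [youngSym_eq_sym]
    rfl
  ext v
  rw [mem_filt_zero, mem_specht]
  constructor
  · rintro ⟨a, rfl⟩
    exact ⟨a * colSym true T, by rw [colGen_eq, mul_assoc]⟩
  · rintro ⟨a, rfl⟩
    refine ⟨κ⁻¹ • (a * colSym false (Prod.swap ∘ T)), ?_⟩
    rw [smul_mul_assoc, mul_assoc, h', mul_smul_comm, inv_smul_smul₀ hκ]

end Models

section Restriction

variable {n : ℕ} {lam ν : YoungDiagram}

/-- Filling the removable box `x` with the last letter extends fillings of `λ \ x`. -/
lemma isFilling_snoc {T' : Fin n → ℕ × ℕ} (hT' : Function.Injective T') {x : ℕ × ℕ}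
    (hx : x ∈ lam) (hr : Set.range T' = ↑(lam.cells.erase x)) :
    IsFilling lam (Fin.snoc (α := fun _ => ℕ × ℕ) T' x) := by
  have hxT : x ∉ Set.range T' := by simp [hr]
  refine ⟨Fin.snoc_injective_iff.mpr ⟨hT', hxT⟩, ?_⟩
  rw [Fin.range_snoc, hr, Finset.coe_erase, Set.insert_sdiff_singleton,
    Set.insert_eq_of_mem (by simpa using hx)]

/-- The eigenspace of the Jucys-Murphy element on the Specht module for the content of `x`,
set to zero when `x` is not removable. -/
def summand (lam : YoungDiagram) (T : Fin (n + 1) → ℕ × ℕ) (x : ℕ × ℕ) :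
    Submodule ℂ (SGA (n + 1)) :=
  if x ∈ Removable lam then
    specht T ⊓ Module.End.eigenspace (LinearMap.mulLeft ℂ (JM n)) (content x)
  else ⊥

lemma mem_summand {T : Fin (n + 1) → ℕ × ℕ} {x : ℕ × ℕ} (hx : x ∈ Removable lam)
    {v : SGA (n + 1)} :
    v ∈ summand lam T x ↔ v ∈ specht T ∧ JM n * v = content x • v := by
  rw [summand, if_pos hx, Submodule.mem_inf, Module.End.mem_eigenspace_iff,
    LinearMap.mulLeft_apply]

lemma summand_eq_bot {T : Fin (n + 1) → ℕ × ℕ} {x : ℕ × ℕ} (hx : x ∉ Removable lam) :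
    summand lam T x = ⊥ :=
  if_neg hx

lemma iSupIndep_summand (T : Fin (n + 1) → ℕ × ℕ) : iSupIndep (summand lam T) := by
  intro x
  by_cases hx : x ∈ Removable lam
  · refine (Module.End.eigenspaces_iSupIndep (LinearMap.mulLeft ℂ (JM n)) (content x)).mono ?_ ?_
    · rw [summand, if_pos hx]
      exact inf_le_right
    · refine iSup₂_le fun y hy => ?_
      by_cases hy' : y ∈ Removable lam
      · rw [summand, if_pos hy']
        exact inf_le_right.trans
          (le_iSup₂_of_le (content y) (content_injOn.ne hy' hx hy) le_rfl)
      · rw [summand_eq_bot hy']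
        exact bot_le
  · rw [summand_eq_bot hx]
    exact disjoint_bot_left

lemma IsFilling.iSup_summand {T : Fin (n + 1) → ℕ × ℕ} (hT : IsFilling lam T) :
    ⨆ x, summand lam T x = specht T := by
  refine le_antisymm (iSup_le fun x => ?_) ?_
  · rw [summand]
    split_ifs
    · exact inf_le_left
    · exact bot_le
  · have h := hT.filt_le_of_eigen ((garnir_sym true T).mul_right (colSym true T))
      (⨆ x, summand lam T x) ?_
    · rwa [← colGen, hT.specht_eq_filt_col] at h
    · intro j hj v hv hc
      have hx := mem_removable_of_corner hj
      rw [← colGen, hT.specht_eq_filt_col] at hv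
      refine Submodule.mem_iSup_of_mem (lam.colLen j - 1, j) ((mem_summand hx).mpr ⟨hv, ?_⟩)
      rw [hc, ← colContent_true hx]

lemma IsFilling.summand_ne_bot {T : Fin (n + 1) → ℕ × ℕ} (hT : IsFilling lam T) {x : ℕ × ℕ}
    (hx : x ∈ Removable lam) : summand lam T x ≠ ⊥ := by
  obtain ⟨w, hw, hw0, hwc⟩ := hT.transpose.exists_eigen_ne_zero false
    (colLen_succ_of_removable (swap_mem_removable hx))
  rw [specht_eq_filt_row] at hw
  rw [Prod.snd_swap, colContent_false hx] at hwc
  exact Submodule.ne_bot_iff _ |>.mpr ⟨w, (mem_summand hx).mpr ⟨hw, hwc⟩, hw0⟩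

lemma res_mul_mem_summand {T : Fin (n + 1) → ℕ × ℕ} {x : ℕ × ℕ} (hx : x ∈ Removable lam)
    (a : SGA n) (v : SGA (n + 1)) (hv : v ∈ summand lam T x) :
    res n a * v ∈ summand lam T x := by
  rw [mem_summand hx] at hv ⊢
  refine ⟨Ideal.mul_mem_left _ _ hv.1, ?_⟩
  rw [← mul_assoc, JM_mul_res, mul_assoc, hv.2, mul_smul_comm]

lemma IsFilling.summand_equiv {T : Fin (n + 1) → ℕ × ℕ} (hT : IsFilling lam T) {x : ℕ × ℕ}
    (hx : x ∈ Removable lam) {T' : Fin n → ℕ × ℕ} (hT' : Function.Injective T')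
    (hr : Set.range T' = ↑(lam.cells.erase x)) :
    ∃ e : summand lam T x ≃ₗ[ℂ] specht T',
      ∀ (a : SGA n) (v : SGA (n + 1)) (hv : v ∈ summand lam T x),
        (e ⟨res n a * v, res_mul_mem_summand hx a v hv⟩ : SGA n) =
          a * (e ⟨v, hv⟩ : SGA n) := by
  obtain ⟨hxl, ν, hν⟩ := hx
  have hx : x ∈ Removable lam := ⟨hxl, ν, hν⟩
  have hfill : IsFilling ν T' := ⟨hT', by rw [hr, hν]⟩
  obtain ⟨σ, hσ⟩ := hT.exists_perm (isFilling_snoc hT' hxl hr)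
  have hlast : T (σ⁻¹ (Fin.last n)) = x := by
    simpa using (congrFun hσ (Fin.last n)).symm
  have hcast : ∀ k : Fin n, T (σ⁻¹ k.castSucc) = T' k := fun k => by
    simpa using (congrFun hσ k.castSucc).symm
  obtain ⟨w, hw, hwc, hwτ, hwgen⟩ := hT.exists_cyclic
    ((garnir_sym true T).mul_right (colSym true T)) σ (j := x.2) (by rw [hlast])
  obtain ⟨u, hu, huc, huτ, hugen⟩ := hT.transpose.exists_cyclic
    (garnir_sym false (Prod.swap ∘ T)) σ (j := x.1)
    (by simp only [Function.comp, hlast, Prod.snd_swap])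
  rw [← colGen, hT.specht_eq_filt_col] at hw hwgen
  rw [specht_eq_filt_row] at hu hugen
  rw [colContent_true hx] at hwc hwgen
  rw [colContent_false hx] at huc hugen
  simp only [Function.comp_apply, hcast] at hwτ huτ
  refine hfill.exists_linearEquiv _ (res_mul_mem_summand hx) (hT.summand_ne_bot hx)
    ((mem_summand hx).mpr ⟨hw, hwc⟩) ((mem_summand hx).mpr ⟨hu, huc⟩) hwτ huτ ?_ ?_
  · intro v hv
    rw [mem_summand hx] at hv
    exact hwgen v hv.1 hv.2
  · intro v hv
    rw [mem_summand hx] at hv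
    exact hugen v hv.1 hv.2

end Restriction

end SpechtBranching

/-- Branching rule and Jucys–Murphy eigenvalues for Specht modules over `ℂ`: for
`λ ⊢ n+1` (with filling `T`), the restriction of `S(λ)` to `S_n` decomposes as a
(multiplicity-free) direct sum `⊕_x W_x` over the removable boxes `x` of `λ`, where
each summand `W_x` is `S_n`-invariant, nonzero, isomorphic to the Specht module
`S(λ \ x)` as an `S_n`-module, and the Jucys–Murphy element `L_{n+1}` acts on `W_x`
by the scalar `c(x) = j - i`; in particular `L_{n+1}` acts on `S(λ)` with eigenvalues
exactly the contents of the removable boxes of `λ`. -/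
theorem stmt_16 (n : ℕ) (lam : YoungDiagram) (hcard : lam.cells.card = n + 1)
    (T : Fin (n + 1) → ℕ × ℕ) (hTinj : Function.Injective T)
    (hTrange : Set.range T = ↑lam.cells) :
    ∃ W : ℕ × ℕ → Submodule ℂ (SGA (n + 1)),
      (∀ x, x ∉ Removable lam → W x = ⊥) ∧
      iSupIndep W ∧
      (⨆ x, W x) = specht T ∧
      ∀ x ∈ Removable lam,
        W x ≠ ⊥ ∧
        (∀ v ∈ W x, JM n * v = ((((x.2 : ℤ) - (x.1 : ℤ)) : ℤ) : ℂ) • v) ∧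
        ∃ hinv : ∀ (a : SGA n) (v : SGA (n + 1)), v ∈ W x → res n a * v ∈ W x,
          ∀ T' : Fin n → ℕ × ℕ, Function.Injective T' →
            Set.range T' = ↑(lam.cells.erase x) →
            ∃ e : (W x) ≃ₗ[ℂ] specht T',
              ∀ (a : SGA n) (v : SGA (n + 1)) (hv : v ∈ W x),
                (e ⟨res n a * v, hinv a v hv⟩ : SGA n) = a * (e ⟨v, hv⟩ : SGA n) := by
  have hT : SpechtBranching.IsFilling lam T := ⟨hTinj, hTrange⟩
  refine ⟨SpechtBranching.summand lam T, fun x hx => SpechtBranching.summand_eq_bot hx,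
    SpechtBranching.iSupIndep_summand T, hT.iSup_summand, fun x hx => ⟨hT.summand_ne_bot hx,
      fun v hv => ((SpechtBranching.mem_summand hx).mp hv).2,
      SpechtBranching.res_mul_mem_summand hx, fun T' hT' hr => hT.summand_equiv hx hT' hr⟩⟩

end
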